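/- arXiv:1501.02421 — 7 statements merged into one kernel-verified Lean document; each statement's English description precedes it below -/
import Mathlib

section
/- Let m ≥ 2 be an integer and let f be a permutation of ℤ/mℤ satisfying f(2b − a) = 2 f(b) − f(a) for all a, b ∈ ℤ/mℤ. Then there exist a unit λ of ℤ/mℤ and an element μ ∈ ℤ/mℤ such that f(x) = λx + μ for all x ∈ ℤ/mℤ. -/
/-- A function on `ℤ/mℤ` with `f(2b − a) = 2 f(b) − f(a)` is an arithmetic progression
on the natural numbers. -/
theorem ZMod.apply_natCast_of_map_two_mul_sub {m : ℕ} {f : ZMod m → ZMod m}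
    (hf : ∀ a b : ZMod m, f (2 * b - a) = 2 * f b - f a) (n : ℕ) :
    f n = (f 1 - f 0) * n + f 0 := by
  induction n using Nat.twoStepInduction with
  | zero => simp
  | one => simp
  | more n ih₀ ih₁ =>
    have h := hf n (n + 1 : ℕ)
    rw [ih₀, ih₁] at h
    convert h using 1
    · congr 1
      push_cast
      ring
    · push_cast
      ring

/-- For `m ≥ 2`, every permutation `f` of `ℤ/mℤ` satisfying
`f(2b − a) = 2 f(b) − f(a)` for all `a, b` is of the form `f(x) = λx + μ`
with `λ` a unit of `ℤ/mℤ` and `μ ∈ ℤ/mℤ`. -/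
theorem stmt_1 (m : ℕ) (hm : 2 ≤ m) (f : Equiv.Perm (ZMod m))
    (hf : ∀ a b : ZMod m, f (2 * b - a) = 2 * f b - f a) :
    ∃ (l : (ZMod m)ˣ) (μ : ZMod m), ∀ x : ZMod m, f x = (l : ZMod m) * x + μ := by
  have : NeZero m := ⟨by omega⟩
  have affine (x : ZMod m) : f x = (f 1 - f 0) * x + f 0 := by
    simpa using ZMod.apply_natCast_of_map_two_mul_sub hf x.val
  obtain ⟨y, hy⟩ := f.surjective (1 + f 0)
  have hunit : (f 1 - f 0) * y = 1 := add_right_cancel ((affine y).symm.trans hy)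
  exact ⟨Units.mkOfMulEqOne _ _ hunit, f 0, affine⟩
end

section
/- Let S be a 5-element subset of ℤ/11ℤ with {0, 1, 2} ⊆ S. Then at least one of the following holds: (i) S is equivalent mod 11 to {0, 1, 2, 3, 6}; (ii) S is equivalent mod 11 to {0, 1, 2, 4, 7}; (iii) S is equivalent mod 11 to {0, 1, 2, 3, 7}; (iv) there is a coloring automorphism f of ℤ/11ℤ with f(S) ⊆ {0, 1, 2, 3, 4, 5} (residues mod 11). -/
/-- Two finite subsets of `ℤ/mℤ` are equivalent mod `m` if a coloring automorphism
`x ↦ λx + μ` (with `λ` a unit) maps one onto the other. -/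
def EquivColorSets (m : ℕ) (S₁ S₂ : Finset (ZMod m)) : Prop :=
  ∃ (l : (ZMod m)ˣ) (μ : ZMod m), S₁.image (fun x => (l : ZMod m) * x + μ) = S₂

/-- A unit witness may be given as a nonzero residue, which makes the existence of a suitable
coloring automorphism decidable by enumeration. -/
theorem exists_coloring_automorphism (a b : ZMod 11)
    (ha : a ∉ ({0, 1, 2} : Finset (ZMod 11))) (hb : b ∉ ({0, 1, 2} : Finset (ZMod 11)))
    (hab : a ≠ b) :
    ∃ l μ : ZMod 11, l ≠ 0 ∧
      (({0, 1, 2, a, b} : Finset (ZMod 11)).image (fun x => l * x + μ) = {0, 1, 2, 3, 6} ∨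
       ({0, 1, 2, a, b} : Finset (ZMod 11)).image (fun x => l * x + μ) = {0, 1, 2, 4, 7} ∨
       ({0, 1, 2, a, b} : Finset (ZMod 11)).image (fun x => l * x + μ) = {0, 1, 2, 3, 7} ∨
       ({0, 1, 2, a, b} : Finset (ZMod 11)).image (fun x => l * x + μ) ⊆
        {0, 1, 2, 3, 4, 5}) := by
  revert a b
  decide +kernel

/-- Every 5-element subset of `ℤ/11ℤ` containing `0, 1, 2` is equivalent mod 11 to
`{0,1,2,3,6}`, to `{0,1,2,4,7}`, or to `{0,1,2,3,7}`, or can be mapped by a coloring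
automorphism into `{0,1,2,3,4,5}`. -/
theorem stmt_8 (S : Finset (ZMod 11)) (hcard : S.card = 5)
    (hsub : ({0, 1, 2} : Finset (ZMod 11)) ⊆ S) :
    EquivColorSets 11 S ({0, 1, 2, 3, 6} : Finset (ZMod 11)) ∨
    EquivColorSets 11 S ({0, 1, 2, 4, 7} : Finset (ZMod 11)) ∨
    EquivColorSets 11 S ({0, 1, 2, 3, 7} : Finset (ZMod 11)) ∨
    ∃ (l : (ZMod 11)ˣ) (μ : ZMod 11),
      S.image (fun x => (l : ZMod 11) * x + μ) ⊆ ({0, 1, 2, 3, 4, 5} : Finset (ZMod 11)) := by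
  obtain ⟨a, b, hab, hdiff⟩ : ∃ a b, a ≠ b ∧ S \ {0, 1, 2} = {a, b} := by
    rw [← Finset.card_eq_two, Finset.card_sdiff_of_subset hsub, hcard]
    decide
  have ha : a ∈ S \ {0, 1, 2} := by simp [hdiff]
  have hb : b ∈ S \ {0, 1, 2} := by simp [hdiff]
  have hS : S = {0, 1, 2, a, b} := by
    rw [← Finset.union_sdiff_of_subset hsub, hdiff]
    rfl
  obtain ⟨l, μ, hl, h⟩ := exists_coloring_automorphism a b (Finset.mem_sdiff.1 ha).2
    (Finset.mem_sdiff.1 hb).2 hab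
  rw [← hS] at h
  have : Fact (Nat.Prime 11) := ⟨by norm_num⟩
  obtain ⟨u, rfl⟩ := isUnit_iff_ne_zero.2 hl
  exact h.imp (⟨u, μ, ·⟩) (Or.imp (⟨u, μ, ·⟩) (Or.imp (⟨u, μ, ·⟩) (⟨u, μ, ·⟩)))
end

section
/- Let S be a 5-element subset of ℤ/13ℤ with {0, 1, 2} ⊆ S. Then at least one of the following holds: (i) S is equivalent mod 13 to {0, 1, 2, 4, 7}; (ii) S is equivalent mod 13 to {0, 1, 2, 4, 10}; (iii) there is a coloring automorphism f of ℤ/13ℤ with f(S) ⊆ {0, 1, 2, 3, 4, 5, 6} (residues mod 13). -/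
theorem equivColorSets_of_ne_zero {p : ℕ} [Fact p.Prime] {S T : Finset (ZMod p)}
    (h : ∃ l : ZMod p, l ≠ 0 ∧ ∃ μ, S.image (fun x => l * x + μ) = T) :
    EquivColorSets p S T := by
  obtain ⟨l, hl, μ, h⟩ := h
  exact ⟨Units.mk0 l hl, μ, h⟩

/-- A 5-element set containing `0, 1, 2` is `{0, 1, 2}` together with a pair. -/
theorem exists_pair_union_eq {S : Finset (ZMod 13)} (hcard : S.card = 5)
    (hsub : ({0, 1, 2} : Finset (ZMod 13)) ⊆ S) :
    ∃ a b : ZMod 13, ({0, 1, 2, a, b} : Finset (ZMod 13)) = S ∧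
      ({0, 1, 2, a, b} : Finset (ZMod 13)).card = 5 := by
  have h : (S \ {0, 1, 2}).card = 2 := by
    rw [Finset.card_sdiff_of_subset hsub, hcard]
    decide
  obtain ⟨a, b, -, hab⟩ := Finset.card_eq_two.mp h
  have hS : ({0, 1, 2, a, b} : Finset (ZMod 13)) = S := by
    rw [← Finset.union_sdiff_of_subset hsub, hab]
    rfl
  exact ⟨a, b, hS, hS ▸ hcard⟩

/-- Either an affine map carries `{0, 1, 2, a, b}` into `{0, …, 6}`, or one carries it onto
`{0, 1, 2, 4, 7}` or `{0, 1, 2, 4, 10}`. -/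
theorem affine_image_classification (a b : ZMod 13)
    (hcard : ({0, 1, 2, a, b} : Finset (ZMod 13)).card = 5) :
    (∃ l : ZMod 13, l ≠ 0 ∧ ∃ μ, ∀ x ∈ ({0, 1, 2, a, b} : Finset (ZMod 13)),
      l * x + μ ∈ ({0, 1, 2, 3, 4, 5, 6} : Finset (ZMod 13))) ∨
    (∃ l : ZMod 13, l ≠ 0 ∧ ∃ μ, ({0, 1, 2, a, b} : Finset (ZMod 13)).image
      (fun x => l * x + μ) = {0, 1, 2, 4, 7}) ∨
    (∃ l : ZMod 13, l ≠ 0 ∧ ∃ μ, ({0, 1, 2, a, b} : Finset (ZMod 13)).image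
      (fun x => l * x + μ) = {0, 1, 2, 4, 10}) := by
  revert a b
  decide +kernel

/-- Every 5-element subset of `ℤ/13ℤ` containing `0, 1, 2` is equivalent mod 13 to
`{0,1,2,4,7}` or to `{0,1,2,4,10}`, or can be mapped by a coloring automorphism into
`{0,1,2,3,4,5,6}`. -/
theorem stmt_9 (S : Finset (ZMod 13)) (hcard : S.card = 5)
    (hsub : ({0, 1, 2} : Finset (ZMod 13)) ⊆ S) :
    EquivColorSets 13 S ({0, 1, 2, 4, 7} : Finset (ZMod 13)) ∨
    EquivColorSets 13 S ({0, 1, 2, 4, 10} : Finset (ZMod 13)) ∨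
    ∃ (l : (ZMod 13)ˣ) (μ : ZMod 13),
      S.image (fun x => (l : ZMod 13) * x + μ) ⊆
        ({0, 1, 2, 3, 4, 5, 6} : Finset (ZMod 13)) := by
  obtain ⟨a, b, rfl, h⟩ := exists_pair_union_eq hcard hsub
  have : Fact (Nat.Prime 13) := ⟨by norm_num⟩
  rcases affine_image_classification a b h with ⟨l, hl, μ, h⟩ | h | h
  · exact Or.inr (Or.inr ⟨Units.mk0 l hl, μ, Finset.image_subset_iff.mpr h⟩)
  · exact Or.inl (equivColorSets_of_ne_zero h)
  · exact Or.inr (Or.inl (equivColorSets_of_ne_zero h))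
end

section
/- Let p ≥ 11 be a prime and let a ∈ ℤ/pℤ with a ∉ {0, 1, 2}. Then at least one of the following holds: (i) there is a coloring automorphism f of ℤ/pℤ such that f({0, 1, 2, a}) is contained in the set of residues of the integers 0, 1, …, (p−1)/2; (ii) for all c ∈ {0, 1, 2, a} and all y ∈ {0, 1, 2}, 2c ≠ a + y in ℤ/pℤ (i.e., a is an isolated vertex of the underlying graph of {0, 1, 2, a}). This is the key dichotomy in the proof that mincol_p L ≥ 5 for every link L with non-zero determinant admitting non-trivial p-colorings. -/
/-- If `2 * c = a + y` with `c ∈ {0, 1, 2, a}`, `y ∈ {0, 1, 2}` and `a ∉ {0, 1, 2}`, then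
`a` is one of the four neighbours `-2, -1, 3, 4` of `{0, 1, 2}`. -/
theorem eq_neg_or_of_two_mul_eq_add {R : Type*} [CommRing R] {a c y : R}
    (h0 : a ≠ 0) (h1 : a ≠ 1) (h2 : a ≠ 2) (hc : c = 0 ∨ c = 1 ∨ c = 2 ∨ c = a)
    (hy : y = 0 ∨ y = 1 ∨ y = 2) (h : 2 * c = a + y) :
    a = -2 ∨ a = -1 ∨ a = 3 ∨ a = 4 := by
  have key : a = 2 * c - y := by linear_combination -h
  rcases hc with rfl | rfl | rfl | rfl <;> rcases hy with rfl | rfl | rfl <;> grind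

/-- For a prime `p ≥ 11` and `a ∈ ℤ/pℤ` with `a ∉ {0, 1, 2}`: either some coloring
automorphism maps `{0, 1, 2, a}` into the residues of `0, 1, …, (p−1)/2`, or `a` is
an isolated vertex of the underlying graph of `{0, 1, 2, a}`. -/
theorem stmt_11 (p : ℕ) (hp : p.Prime) (hp11 : 11 ≤ p) (a : ZMod p)
    (ha : a ∉ ({0, 1, 2} : Finset (ZMod p))) :
    (∃ (l : (ZMod p)ˣ) (μ : ZMod p),
      ({0, 1, 2, a} : Finset (ZMod p)).image (fun x => (l : ZMod p) * x + μ) ⊆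
        (Finset.range ((p - 1) / 2 + 1)).image (fun n : ℕ => (n : ZMod p))) ∨
    (∀ c ∈ ({0, 1, 2, a} : Finset (ZMod p)), ∀ y ∈ ({0, 1, 2} : Finset (ZMod p)),
      2 * c ≠ a + y) := by
  rw [or_iff_not_imp_right]
  intro h
  push Not at h
  obtain ⟨c, hc, y, hy, h⟩ := h
  simp only [Finset.mem_insert, Finset.mem_singleton, not_or] at ha hc hy
  have small (n : ℕ) (hn : n ≤ 4) (x : ZMod p) (hx : x = n) :
      x ∈ (Finset.range ((p - 1) / 2 + 1)).image (fun n : ℕ => (n : ZMod p)) :=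
    Finset.mem_image.2 ⟨n, Finset.mem_range.2 (by omega), hx.symm⟩
  have translate (m k : ℕ) (hm : m ≤ 2) (hk : k ≤ 4) (ham : a + m = k) :
      ∃ (l : (ZMod p)ˣ) (μ : ZMod p),
        ({0, 1, 2, a} : Finset (ZMod p)).image (fun x => (l : ZMod p) * x + μ) ⊆
          (Finset.range ((p - 1) / 2 + 1)).image (fun n : ℕ => (n : ZMod p)) := by
    refine ⟨1, m, Finset.image_subset_iff.2 fun x hx => ?_⟩
    simp only [Finset.mem_insert, Finset.mem_singleton] at hx
    rcases hx with rfl | rfl | rfl | rfl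
    · exact small m (by omega) _ (by simp)
    · exact small (1 + m) (by omega) _ (by simp)
    · exact small (2 + m) (by omega) _ (by simp)
    · exact small k hk _ (by simpa using ham)
  rcases eq_neg_or_of_two_mul_eq_add ha.1 ha.2.1 ha.2.2 hc hy h with rfl | rfl | rfl | rfl
  · exact translate 2 0 (by norm_num) (by norm_num) (by norm_num)
  · exact translate 1 0 (by norm_num) (by norm_num) (by norm_num)
  · exact translate 0 3 (by norm_num) (by norm_num) (by norm_num)
  · exact translate 0 4 (by norm_num) (by norm_num) (by norm_num)
end

section
/- Let p ≥ 17 be a prime and let S be a 5-element subset of ℤ/pℤ. Suppose S contains four distinct elements whose canonical integer representatives x₁ < x₂ < x₃ < x₄ (with 0 ≤ xᵢ ≤ p−1) satisfy x₄ − x₁ ≤ 4. Then at least one of the following holds: (i) there is a coloring automorphism f of ℤ/pℤ such that f(S) is contained in the set of residues of the integers 0, 1, …, (p−1)/2; (ii) there exists e ∈ S such that for all c ∈ S and all y ∈ S with y ≠ e, 2c ≠ e + y in ℤ/pℤ (i.e., e is an isolated vertex of the underlying graph of S). This is the Claim in the proof that mincol_p L ≥ 6 for every link L with non-zero determinant admitting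 non-trivial p-colorings, p ≥ 17. -/
/-- A subset of `ℤ/pℤ` all of whose elements lie in a window of length at most five, except
possibly one, either has a translate in the lower half of the residues or has that exceptional
element as an isolated vertex. -/
theorem translate_subset_lower_half_or_isolated {p : ℕ} (hodd : Odd p) (hp17 : 17 ≤ p)
    (S : Finset (ZMod p)) (a z : ZMod p) (hz : z ∈ S)
    (hS : ∀ s ∈ S, s = z ∨ ∃ n : ℕ, n ≤ 4 ∧ s = a + n) :
    (∃ μ : ZMod p, S.image (fun x => x + μ) ⊆
        (Finset.range ((p - 1) / 2 + 1)).image (fun n : ℕ => (n : ZMod p))) ∨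
    (∃ e ∈ S, ∀ c ∈ S, ∀ y ∈ S, y ≠ e → 2 * c ≠ e + y) := by
  obtain ⟨m, rfl⟩ := hodd
  have hm : (2 * m + 1 - 1) / 2 = m := by omega
  rw [hm]
  obtain ⟨t, ht, rfl⟩ : ∃ t : ℕ, t < 2 * m + 1 ∧ z = a + t :=
    ⟨(z - a).val, ZMod.val_lt _, by rw [ZMod.natCast_zmod_val]; ring⟩
  rcases le_or_gt t m with h1 | h1
  · left
    refine ⟨-a, ?_⟩
    intro y hy
    obtain ⟨s, hs, rfl⟩ := Finset.mem_image.1 hy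
    rw [Finset.mem_image]
    rcases hS s hs with rfl | ⟨n, hn, rfl⟩
    · exact ⟨t, Finset.mem_range.2 (by omega), by ring⟩
    · exact ⟨n, Finset.mem_range.2 (by omega), by ring⟩
  rcases le_or_gt (m + 5) t with h2 | h2
  · left
    refine ⟨-a + ((m - 4 : ℕ) : ZMod (2 * m + 1)), ?_⟩
    intro y hy
    obtain ⟨s, hs, rfl⟩ := Finset.mem_image.1 hy
    rw [Finset.mem_image]
    rcases hS s hs with rfl | ⟨n, hn, rfl⟩
    · refine ⟨t + (m - 4) - (2 * m + 1), Finset.mem_range.2 (by omega), ?_⟩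
      rw [Nat.cast_sub (by omega), ZMod.natCast_self, Nat.cast_add]
      ring
    · refine ⟨n + (m - 4), Finset.mem_range.2 (by omega), ?_⟩
      rw [Nat.cast_add]
      ring
  · right
    refine ⟨_, hz, fun c hc y hy hne h => ?_⟩
    rcases hS y hy with rfl | ⟨k, hk, rfl⟩
    · exact hne rfl
    rcases hS c hc with rfl | ⟨n, hn, rfl⟩
    · exact hne (by linear_combination -h)
    · have h0 : ((t + k - 2 * n : ℕ) : ZMod (2 * m + 1)) = 0 := by
        rw [Nat.cast_sub (by omega)]
        push_cast
        linear_combination -h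
      have := Nat.le_of_dvd (by omega) ((ZMod.natCast_eq_zero_iff _ _).1 h0)
      omega


/-- The Claim in the proof that `mincol_p L ≥ 6` for primes `p ≥ 17`: if a 5-element
subset `S` of `ℤ/pℤ` contains four distinct elements whose canonical integer
representatives `x₁ < x₂ < x₃ < x₄` satisfy `x₄ − x₁ ≤ 4`, then either some
coloring automorphism maps `S` into the residues of `0, 1, …, (p−1)/2`, or some
element of `S` is an isolated vertex of the underlying graph of `S`. -/
theorem stmt_12 (p : ℕ) (hp : p.Prime) (hp17 : 17 ≤ p) (S : Finset (ZMod p))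
    (hcard : S.card = 5)
    (hfour : ∃ x₁ x₂ x₃ x₄ : ZMod p, x₁ ∈ S ∧ x₂ ∈ S ∧ x₃ ∈ S ∧ x₄ ∈ S ∧
      x₁.val < x₂.val ∧ x₂.val < x₃.val ∧ x₃.val < x₄.val ∧ x₄.val - x₁.val ≤ 4) :
    (∃ (l : (ZMod p)ˣ) (μ : ZMod p),
      S.image (fun x => (l : ZMod p) * x + μ) ⊆
        (Finset.range ((p - 1) / 2 + 1)).image (fun n : ℕ => (n : ZMod p))) ∨
    (∃ e ∈ S, ∀ c ∈ S, ∀ y ∈ S, y ≠ e → 2 * c ≠ e + y) := by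
  have : NeZero p := ⟨hp.ne_zero⟩
  obtain ⟨x₁, x₂, x₃, x₄, m₁, m₂, m₃, m₄, h₁, h₂, h₃, h₄⟩ := hfour
  have hne : ∀ {x y : ZMod p}, x.val < y.val → x ≠ y := fun h e => by simp [e] at h
  have hsub : ({x₁, x₂, x₃, x₄} : Finset (ZMod p)) ⊆ S := by
    simp [Finset.insert_subset_iff, *]
  have hcard4 : ({x₁, x₂, x₃, x₄} : Finset (ZMod p)).card = 4 := by
    simp [hne h₁, hne h₂, hne h₃, hne (h₁.trans h₂), hne (h₂.trans h₃),
      hne (h₁.trans (h₂.trans h₃))]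
  obtain ⟨z, hz⟩ : ∃ z, S \ {x₁, x₂, x₃, x₄} = {z} := by
    rw [← Finset.card_eq_one, Finset.card_sdiff_of_subset hsub, hcard, hcard4]
  have hzS : z ∈ S := (Finset.mem_sdiff.1 (hz ▸ Finset.mem_singleton_self z)).1
  have hwin : ∀ x : ZMod p, x₁.val ≤ x.val → x.val ≤ x₄.val →
      ∃ n : ℕ, n ≤ 4 ∧ x = x₁ + n := fun x hl hu =>
    ⟨x.val - x₁.val, by omega, by
      rw [Nat.cast_sub hl, ZMod.natCast_zmod_val, ZMod.natCast_zmod_val]; ring⟩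
  have hS : ∀ s ∈ S, s = z ∨ ∃ n : ℕ, n ≤ 4 ∧ s = x₁ + n := by
    intro s hs
    by_cases hmem : s ∈ ({x₁, x₂, x₃, x₄} : Finset (ZMod p))
    · right
      simp only [Finset.mem_insert, Finset.mem_singleton] at hmem
      rcases hmem with rfl | rfl | rfl | rfl <;> exact hwin _ (by omega) (by omega)
    · left
      exact Finset.mem_singleton.1 (hz ▸ Finset.mem_sdiff.2 ⟨hs, hmem⟩)
  refine (translate_subset_lower_half_or_isolated (hp.odd_of_ne_two (by omega)) hp17 S x₁ z hzS
    hS).imp_left fun ⟨μ, hμ⟩ => ⟨1, μ, ?_⟩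
  simpa only [Units.val_one, one_mul] using hμ
end

section
/- Let p ≥ 17 be a prime, let γ ∈ {0, 2, 4} be an integer, and let a, b be integers such that either (3a = p + γ + 1 and 3b = 2p + 2γ − 1) or (3a = p + 2γ − 1 and 3b = 2p + γ + 1). Then in ℤ/pℤ the map x ↦ 3x + 1 sends the set {0, 1, 2, a, b} (residues mod p) onto the set of residues of {1, 4, 7, γ + 2, 2γ}, which is contained in the set of residues of the integers 0, 1, …, (p−1)/2. -/
/-- Case 2 in the proof that `mincol_p L ≥ 6` for `p ≥ 17`: if `γ ∈ {0, 2, 4}` and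
either (`3a = p + γ + 1` and `3b = 2p + 2γ − 1`) or (`3a = p + 2γ − 1` and
`3b = 2p + γ + 1`), then the coloring automorphism `x ↦ 3x + 1` maps
`{0, 1, 2, a, b}` (mod `p`) onto the residues of `{1, 4, 7, γ + 2, 2γ}`,
a subset of the residues of `0, 1, …, (p−1)/2`. -/
theorem stmt_15 (p : ℕ) (hp : p.Prime) (hp17 : 17 ≤ p) (γ a b : ℤ)
    (hγ : γ ∈ ({0, 2, 4} : Finset ℤ))
    (hab : (3 * a = (p : ℤ) + γ + 1 ∧ 3 * b = 2 * (p : ℤ) + 2 * γ - 1) ∨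
           (3 * a = (p : ℤ) + 2 * γ - 1 ∧ 3 * b = 2 * (p : ℤ) + γ + 1)) :
    ({0, 1, 2, (a : ZMod p), (b : ZMod p)} : Finset (ZMod p)).image
        (fun x => 3 * x + 1) =
      ({1, 4, 7, ((γ + 2 : ℤ) : ZMod p), ((2 * γ : ℤ) : ZMod p)} : Finset (ZMod p)) ∧
    ({1, 4, 7, ((γ + 2 : ℤ) : ZMod p), ((2 * γ : ℤ) : ZMod p)} : Finset (ZMod p)) ⊆
      (Finset.range ((p - 1) / 2 + 1)).image (fun n : ℕ => (n : ZMod p)) := by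
  constructor
  · have cast_eq {m n : ℤ} (h : m = n) : (m : ZMod p) = n := congrArg _ h
    rcases hab with ⟨ha, hb⟩ | ⟨ha, hb⟩
    · have ha' : 3 * (a : ZMod p) + 1 = ((γ + 2 : ℤ) : ZMod p) := by
        have := cast_eq ha
        push_cast [ZMod.natCast_self] at this ⊢
        linear_combination this
      have hb' : 3 * (b : ZMod p) + 1 = ((2 * γ : ℤ) : ZMod p) := by
        have := cast_eq hb
        push_cast [ZMod.natCast_self] at this ⊢
        linear_combination this
      simp only [Finset.image_insert, Finset.image_singleton, ha', hb']
      norm_num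
    · have ha' : 3 * (a : ZMod p) + 1 = ((2 * γ : ℤ) : ZMod p) := by
        have := cast_eq ha
        push_cast [ZMod.natCast_self] at this ⊢
        linear_combination this
      have hb' : 3 * (b : ZMod p) + 1 = ((γ + 2 : ℤ) : ZMod p) := by
        have := cast_eq hb
        push_cast [ZMod.natCast_self] at this ⊢
        linear_combination this
      simp only [Finset.image_insert, Finset.image_singleton, ha', hb']
      rw [Finset.pair_comm]
      norm_num
  · have small_mem (n : ℕ) (hn : n ≤ 8) :
        (n : ZMod p) ∈ (Finset.range ((p - 1) / 2 + 1)).image (fun n : ℕ => (n : ZMod p)) :=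
      Finset.mem_image_of_mem _ (Finset.mem_range.2 (by omega))
    have small_mem_int (m : ℤ) (h0 : 0 ≤ m) (h8 : m ≤ 8) :
        (m : ZMod p) ∈ (Finset.range ((p - 1) / 2 + 1)).image (fun n : ℕ => (n : ZMod p)) := by
      lift m to ℕ using h0
      simpa only [Int.cast_natCast] using small_mem m (by omega)
    have hγ_bounds : 0 ≤ γ ∧ γ ≤ 4 := by
      simp only [Finset.mem_insert, Finset.mem_singleton] at hγ
      omega
    simp only [Finset.insert_subset_iff, Finset.singleton_subset_iff]
    exact ⟨mod_cast small_mem 1 (by omega), mod_cast small_mem 4 (by omega),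
      mod_cast small_mem 7 (by omega), small_mem_int _ (by omega) (by omega),
      small_mem_int _ (by omega) (by omega)⟩
end

section
/- There exist six 6-element subsets T₁, …, T₆ of ℤ/11ℤ, pairwise inequivalent mod 11, such that every 6-element subset of ℤ/11ℤ containing 0, 1, and 2 is equivalent mod 11 to exactly one of T₁, …, T₆. (That is, the 56 six-element subsets of ℤ/11ℤ containing {0, 1, 2} fall into exactly 6 equivalence classes.) -/
theorem EquivColorSets.symm {m : ℕ} {S₁ S₂ : Finset (ZMod m)} (h : EquivColorSets m S₁ S₂) :
    EquivColorSets m S₂ S₁ := by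
  obtain ⟨l, μ, rfl⟩ := h
  refine ⟨l⁻¹, -((l⁻¹ : (ZMod m)ˣ) * μ), ?_⟩
  simp [Finset.image_image, Function.comp_def, mul_add]

theorem EquivColorSets.trans {m : ℕ} {S₁ S₂ S₃ : Finset (ZMod m)} (h : EquivColorSets m S₁ S₂)
    (h' : EquivColorSets m S₂ S₃) : EquivColorSets m S₁ S₃ := by
  obtain ⟨l, μ, rfl⟩ := h
  obtain ⟨l', μ', rfl⟩ := h'
  refine ⟨l' * l, l' * μ + μ', ?_⟩
  simp [Finset.image_image, Function.comp_def, mul_add, mul_assoc, add_assoc]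

theorem equivColorSets_prime_iff {p : ℕ} (hp : p.Prime) {S₁ S₂ : Finset (ZMod p)}
    (hc : S₁.card = S₂.card) :
    EquivColorSets p S₁ S₂ ↔ ∃ l μ : ZMod p, l ≠ 0 ∧ ∀ x ∈ S₁, l * x + μ ∈ S₂ := by
  have : Fact p.Prime := ⟨hp⟩
  constructor
  · rintro ⟨l, μ, rfl⟩
    exact ⟨l, μ, l.ne_zero, fun x hx => Finset.mem_image_of_mem _ hx⟩
  · rintro ⟨l, μ, hl, h⟩
    refine ⟨Units.mk0 l hl, μ, Finset.eq_of_subset_of_card_le (Finset.image_subset_iff.2 h) ?_⟩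
    rw [Finset.card_image_of_injective, hc]
    intro x y hxy
    simpa [hl] using hxy

/-- Least residues of representatives of the equivalence classes of 6-element subsets of
`ℤ/11ℤ`. -/
def sixSubsetResidues : Fin 6 → Finset ℕ :=
  ![{0, 1, 2, 3, 4, 5},
    {0, 1, 2, 3, 4, 6},
    {0, 1, 2, 3, 4, 7},
    {0, 1, 2, 3, 5, 6},
    {0, 1, 2, 3, 5, 9},
    {0, 1, 2, 4, 5, 7}]

/-- Representatives of the equivalence classes of 6-element subsets of `ℤ/11ℤ`. -/
def sixSubsetRep (i : Fin 6) : Finset (ZMod 11) :=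
  (sixSubsetResidues i).image Nat.cast

theorem natCast_mem_sixSubsetRep {i : Fin 6} {n : ℕ} (h : n % 11 ∈ sixSubsetResidues i) :
    (n : ZMod 11) ∈ sixSubsetRep i := by
  rw [← ZMod.natCast_mod n 11]
  exact Finset.mem_image_of_mem _ h

theorem card_sixSubsetRep (i : Fin 6) : (sixSubsetRep i).card = 6 := by
  decide +kernel +revert

theorem not_equivColorSets_sixSubsetRep {i j : Fin 6} (hij : i ≠ j) :
    ¬ EquivColorSets 11 (sixSubsetRep i) (sixSubsetRep j) := by
  rw [equivColorSets_prime_iff Nat.prime_eleven (by simp only [card_sixSubsetRep])]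
  decide +kernel +revert

/-- The search runs over natural numbers because the kernel evaluates their arithmetic much
faster than that of `ZMod 11`. -/
theorem exists_affine_mod_mem_sixSubsetResidues :
    ∀ A ∈ Finset.powersetCard 3 ({3, 4, 5, 6, 7, 8, 9, 10} : Finset ℕ),
      ∃ i : Fin 6, ∃ l < 11, ∃ μ < 11, l ≠ 0 ∧
        (∀ x ∈ ({0, 1, 2} : Finset ℕ), (l * x + μ) % 11 ∈ sixSubsetResidues i) ∧
        ∀ x ∈ A, (l * x + μ) % 11 ∈ sixSubsetResidues i := by
  decide +kernel

theorem exists_equivColorSets_sixSubsetRep {S : Finset (ZMod 11)} (hS : S.card = 6)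
    (h : ({0, 1, 2} : Finset (ZMod 11)) ⊆ S) :
    ∃ i : Fin 6, EquivColorSets 11 S (sixSubsetRep i) := by
  have hA : (S \ {0, 1, 2}).image ZMod.val ∈
      Finset.powersetCard 3 ({3, 4, 5, 6, 7, 8, 9, 10} : Finset ℕ) := by
    rw [Finset.mem_powersetCard, Finset.card_image_of_injective _ (ZMod.val_injective 11),
      Finset.card_sdiff_of_subset h, hS]
    refine ⟨(Finset.image_subset_image
      (Finset.sdiff_subset_sdiff (Finset.subset_univ S) subset_rfl)).trans ?_, ?_⟩ <;>
      decide +kernel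
  obtain ⟨i, l, hl, μ, -, hl0, h₁, h₂⟩ := exists_affine_mod_mem_sixSubsetResidues _ hA
  refine ⟨i, (equivColorSets_prime_iff Nat.prime_eleven (hS.trans (card_sixSubsetRep i).symm)).2
    ⟨l, μ, ?_, fun x hx => ?_⟩⟩
  · rw [Ne, ZMod.natCast_eq_zero_iff]
    exact Nat.not_dvd_of_pos_of_lt (Nat.pos_of_ne_zero hl0) hl
  · have hmem : (l * x.val + μ) % 11 ∈ sixSubsetResidues i := by
      by_cases hx' : x ∈ ({0, 1, 2} : Finset (ZMod 11))
      · have : x.val ∈ ({0, 1, 2} : Finset ℕ) := by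
          clear * - hx'
          decide +kernel +revert
        exact h₁ _ this
      · exact h₂ _ (Finset.mem_image_of_mem _ (Finset.mem_sdiff.2 ⟨hx, hx'⟩))
    simpa using natCast_mem_sixSubsetRep hmem

/-- The 6-element subsets of `ℤ/11ℤ` containing `{0, 1, 2}` fall into exactly 6
equivalence classes mod 11. -/
theorem stmt_17 :
    ∃ T : Fin 6 → Finset (ZMod 11),
      (∀ i, (T i).card = 6) ∧
      (∀ i j, i ≠ j → ¬ EquivColorSets 11 (T i) (T j)) ∧
      (∀ S : Finset (ZMod 11), S.card = 6 → ({0, 1, 2} : Finset (ZMod 11)) ⊆ S →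
        ∃! i : Fin 6, EquivColorSets 11 S (T i)) := by
  refine ⟨sixSubsetRep, card_sixSubsetRep, fun _ _ => not_equivColorSets_sixSubsetRep,
    fun S hS h => ?_⟩
  obtain ⟨i, hi⟩ := exists_equivColorSets_sixSubsetRep hS h
  refine ⟨i, hi, fun j hj => ?_⟩
  by_contra hji
  exact not_equivColorSets_sixSubsetRep hji (hj.symm.trans hi)
end
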